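/- Let Φ : U → ℂ² be a submersive complex-harmonic morphism on an open set U ⊆ ℂ³ (i.e. dΦ_p : ℂ³ → ℂ² is surjective for every p ∈ U). Then every connected component of every fibre Φ⁻¹(q) (q ∈ ℂ²) is an open subset of an affine complex line in ℂ³, i.e. of a set of the form {p + tw : t ∈ ℂ} with w ∈ ℂ³ ∖ {0}. -/

import Mathlib

noncomputable section

/-- Bicomplex multiplication on `𝔹 = ℂ × ℂ`. -/
def bmul (q w : ℂ × ℂ) : ℂ × ℂ := (q.1 * w.1 - q.2 * w.2, q.1 * w.2 + q.2 * w.1)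

/-- Complex (square) norm of a bicomplex number. -/
def bN (q : ℂ × ℂ) : ℂ := q.1 ^ 2 + q.2 ^ 2

/-- Complex Laplacian of `f : ℂ^m → ℂ`. -/
def lapC {m : ℕ} (f : (Fin m → ℂ) → ℂ) (p : Fin m → ℂ) : ℂ :=
  ∑ k, fderiv ℂ (fun z => fderiv ℂ f z (Pi.single k 1)) p (Pi.single k 1)

/-- Complex gradient of `f : ℂ^m → ℂ`. -/
def gradC {m : ℕ} (f : (Fin m → ℂ) → ℂ) (p : Fin m → ℂ) : Fin m → ℂ :=
  fun k => fderiv ℂ f p (Pi.single k 1)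

/-- Complex-bilinear inner product on `ℂ^m`. -/
def innC {m : ℕ} (u v : Fin m → ℂ) : ℂ := ∑ k, u k * v k

/-- Complex-harmonic (holomorphic) function on an open set `V ⊆ ℂ^m`. -/
def ComplexHarmonicOn {m : ℕ} (f : (Fin m → ℂ) → ℂ) (V : Set (Fin m → ℂ)) : Prop :=
  DifferentiableOn ℂ f V ∧ ∀ p ∈ V, lapC f p = 0

/-- Complex Laplacian of `f : ℂ² → ℂ` (coordinates `q₁, q₂` on `𝔹 = ℂ²`). -/
def lapB (f : ℂ × ℂ → ℂ) (p : ℂ × ℂ) : ℂ :=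
  fderiv ℂ (fun w => fderiv ℂ f w ((1 : ℂ), (0 : ℂ))) p ((1 : ℂ), (0 : ℂ)) +
  fderiv ℂ (fun w => fderiv ℂ f w ((0 : ℂ), (1 : ℂ))) p ((0 : ℂ), (1 : ℂ))

/-- Complex-harmonic function on an open set `V ⊆ ℂ² = 𝔹`. -/
def ComplexHarmonicOnB (f : ℂ × ℂ → ℂ) (V : Set (ℂ × ℂ)) : Prop :=
  DifferentiableOn ℂ f V ∧ ∀ p ∈ V, lapB f p = 0

/-- Complex-harmonic morphism `ℂ^m ⊇ U → ℂ² = 𝔹`: pulls back complex-harmonic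
functions on open subsets of `ℂ²` to complex-harmonic functions. -/
def IsCHMB {m : ℕ} (Φ : (Fin m → ℂ) → ℂ × ℂ) (U : Set (Fin m → ℂ)) : Prop :=
  ∀ V : Set (ℂ × ℂ), IsOpen V → ∀ f : ℂ × ℂ → ℂ,
    ComplexHarmonicOnB f V → (U ∩ Φ ⁻¹' V).Nonempty →
      ComplexHarmonicOn (f ∘ Φ) (U ∩ Φ ⁻¹' V)

/-- The bicomplex gradient `grad_ℂ Φ ∈ 𝔹^m` of `Φ : ℂ^m → 𝔹`. -/
def gradB {m : ℕ} (Φ : (Fin m → ℂ) → ℂ × ℂ) (p : Fin m → ℂ) : Fin m → ℂ × ℂ :=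
  fun k => (fderiv ℂ (fun z => (Φ z).1) p (Pi.single k 1),
            fderiv ℂ (fun z => (Φ z).2) p (Pi.single k 1))


section Holomorphic

open Metric Set Filter Topology

variable {E F : Type*} [NormedAddCommGroup E] [NormedSpace ℂ E]
  [NormedAddCommGroup F] [NormedSpace ℂ F]

/-- A holomorphic map has locally bounded derivative. -/
theorem DifferentiableOn.exists_ball_norm_fderiv_le {f : E → F} {U : Set E} {x : E}
    (hf : DifferentiableOn ℂ f U) (hU : IsOpen U) (hx : x ∈ U) :
    ∃ ρ > 0, ∃ C ≥ 0, ball x (2 * ρ) ⊆ U ∧ ∀ z ∈ ball x (2 * ρ), ‖fderiv ℂ f z‖ ≤ C := by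
  have hc : ContinuousAt f x := (hf.differentiableAt (hU.mem_nhds hx)).continuousAt
  obtain ⟨r, hr, hrU⟩ := Metric.mem_nhds_iff.1
    (inter_mem (hU.mem_nhds hx) (hc.preimage_mem_nhds (ball_mem_nhds (f x) one_pos)))
  refine ⟨r / 4, by positivity, 2 / (r / 2), by positivity, fun z hz => (hrU ?_).1, fun z hz => ?_⟩
  · exact ball_subset_ball (by linarith) hz
  · have hsub : ball z (r / 2) ⊆ ball x r := ball_subset_ball' (by
      rw [mem_ball] at hz; linarith)
    refine Complex.norm_fderiv_le_div_of_mapsTo_ball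
      (hf.mono fun y hy => (hrU (hsub hy)).1) (fun y hy => ?_) (by positivity)
    have h1 : Dist.dist (f y) (f x) < 1 := (hrU (hsub hy)).2
    have h2 : Dist.dist (f z) (f x) < 1 := (hrU (hsub (mem_ball_self (by positivity)))).2
    rw [mem_closedBall]
    linarith [dist_triangle_right (f y) (f z) (f x)]

/-- The derivative of a holomorphic map is continuous. -/
theorem DifferentiableOn.continuousAt_fderiv {f : E → F} {U : Set E} {x : E}
    (hf : DifferentiableOn ℂ f U) (hU : IsOpen U) (hx : x ∈ U) :
    ContinuousAt (fderiv ℂ f) x := by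
  obtain ⟨ρ, hρ, C, hC, hball, hbound⟩ := hf.exists_ball_norm_fderiv_le hU hx
  have hda : ∀ z ∈ ball x (2 * ρ), DifferentiableAt ℂ f z := fun z hz =>
    hf.differentiableAt (hU.mem_nhds (hball hz))
  refine continuousAt_of_locally_lipschitz hρ (2 * C / ρ) fun y hy => ?_
  have hmem : ∀ z ∈ ball x ρ, z + (y - x) ∈ ball x (2 * ρ) := fun z hz => by
    rw [mem_ball, dist_eq_norm] at *
    calc ‖z + (y - x) - x‖ = ‖(z - x) + (y - x)‖ := by congr 1; abel
      _ ≤ ‖z - x‖ + ‖y - x‖ := norm_add_le _ _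
      _ < 2 * ρ := by linarith
  have hmem' : ∀ z ∈ ball x ρ, z ∈ ball x (2 * ρ) := fun z hz =>
    ball_subset_ball (by linarith) hz
  set g : E → F := fun z => f (z + (y - x)) - f z with hg
  have hder : ∀ z ∈ ball x ρ,
      HasFDerivAt g (fderiv ℂ f (z + (y - x)) - fderiv ℂ f z) z := fun z hz =>
    ((hasFDerivAt_comp_add_right _).2 (hda _ (hmem z hz)).hasFDerivAt).sub (hda _ (hmem' z hz)).hasFDerivAt
  have hgn : ∀ z ∈ ball x ρ, ‖g z‖ ≤ C * ‖y - x‖ := fun z hz => by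
    simpa using (convex_ball x (2 * ρ)).norm_image_sub_le_of_norm_fderiv_le (𝕜 := ℂ) hda hbound
      (hmem' z hz) (hmem z hz)
  have hx0 : x ∈ ball x ρ := mem_ball_self hρ
  have := Complex.norm_fderiv_le_div_of_mapsTo_ball (f := g) (c := x) (R₁ := ρ)
    (R₂ := 2 * (C * ‖y - x‖)) (fun z hz => (hder z hz).differentiableAt.differentiableWithinAt)
    (fun z hz => by
      rw [mem_closedBall, dist_eq_norm]
      linarith [norm_sub_le (g z) (g x), hgn z hz, hgn x hx0]) hρ
  rw [(hder x hx0).fderiv, add_sub_cancel] at this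
  rw [dist_eq_norm, dist_eq_norm]
  convert this using 1
  ring

theorem DifferentiableOn.hasStrictFDerivAt {f : E → F} {U : Set E} {x : E}
    (hf : DifferentiableOn ℂ f U) (hU : IsOpen U) (hx : x ∈ U) :
    HasStrictFDerivAt f (fderiv ℂ f x) x :=
  hasStrictFDerivAt_of_hasFDerivAt_of_continuousAt
    (eventually_of_mem (hU.mem_nhds hx) fun _ hy =>
      (hf.differentiableAt (hU.mem_nhds hy)).hasFDerivAt) (hf.continuousAt_fderiv hU hx)

/-- Directional derivatives of a holomorphic map are holomorphic. -/
theorem DifferentiableOn.fderiv_apply [CompleteSpace F] {f : E → F} {U : Set E}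
    (hf : DifferentiableOn ℂ f U) (hU : IsOpen U) (e : E) :
    DifferentiableOn ℂ (fun z => fderiv ℂ f z e) U := by
  intro x hx
  apply DifferentiableAt.differentiableWithinAt
  obtain ⟨ρ, hρ, C, hC, hball, hbound⟩ := hf.exists_ball_norm_fderiv_le hU hx
  obtain ⟨r, hr, hre⟩ : ∃ r > 0, r * ‖e‖ < ρ := by
    refine ⟨ρ / (‖e‖ + 1), by positivity, ?_⟩
    rw [div_mul_eq_mul_div, div_lt_iff₀ (by positivity)]
    nlinarith
  have hmem : ∀ z ∈ ball x ρ, ∀ s ∈ closedBall (0 : ℂ) r, z + s • e ∈ ball x (2 * ρ) := by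
    intro z hz s hs
    rw [mem_ball, dist_eq_norm] at *
    rw [mem_closedBall_zero_iff] at hs
    calc ‖z + s • e - x‖ = ‖(z - x) + s • e‖ := by congr 1; abel
      _ ≤ ‖z - x‖ + ‖s‖ * ‖e‖ := (norm_add_le _ _).trans_eq (by rw [norm_smul])
      _ < 2 * ρ := by nlinarith [norm_nonneg e, mul_le_mul_of_nonneg_right hs (norm_nonneg e)]
  have hda : ∀ z ∈ ball x (2 * ρ), DifferentiableAt ℂ f z := fun z hz =>
    hf.differentiableAt (hU.mem_nhds (hball hz))
  have hcauchy : ∀ z ∈ ball x ρ,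
      Complex.cderiv r (fun s : ℂ => f (z + s • e)) 0 = fderiv ℂ f z e := by
    intro z hz
    have hopen : IsOpen ((fun s : ℂ => z + s • e) ⁻¹' ball x (2 * ρ)) :=
      isOpen_ball.preimage (by fun_prop)
    rw [Complex.cderiv_eq_deriv hopen (fun s hs => ?_) hr (hmem z hz)]
    · have h0 : DifferentiableAt ℂ f (z + (0 : ℂ) • e) := hda _ (hmem z hz 0 (by simp [hr.le]))
      have h1 : HasDerivAt (fun s : ℂ => z + s • e) e 0 := by
        simpa using ((hasDerivAt_id (0 : ℂ)).smul_const e).const_add z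
      simpa [Function.comp_def] using (h0.hasFDerivAt.comp_hasDerivAt (0 : ℂ) h1).deriv
    · exact ((hda _ hs).comp s (by fun_prop)).differentiableWithinAt
  have hsphere : ∀ θ : ℝ, circleMap 0 r θ ∈ closedBall (0 : ℂ) r := fun θ =>
    circleMap_mem_closedBall 0 hr.le θ
  set k : ℝ → ℂ := fun θ => _root_.deriv (circleMap 0 r) θ * ((circleMap 0 r θ - 0) ^ 2)⁻¹ with hk
  have hkc : Continuous k := by
    have : ∀ θ, (circleMap 0 r θ - 0) ^ 2 ≠ 0 := fun θ => by
      simpa using hr.ne'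
    simp only [hk, deriv_circleMap]
    fun_prop (disch := assumption)
  have hFc : ∀ z ∈ ball x ρ, Continuous fun θ : ℝ => k θ • f (z + circleMap 0 r θ • e) :=
    fun z hz => hkc.smul (continuous_iff_continuousAt.2 fun θ =>
      ContinuousAt.comp (f := fun θ : ℝ => z + circleMap 0 r θ • e)
        (hda _ (hmem z hz _ (hsphere θ))).continuousAt (by fun_prop))
  have hF'c : Continuous fun θ : ℝ => k θ • fderiv ℂ f (x + circleMap 0 r θ • e) :=
    hkc.smul (continuous_iff_continuousAt.2 fun θ =>
      ContinuousAt.comp (f := fun θ : ℝ => x + circleMap 0 r θ • e)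
        (hf.continuousAt_fderiv hU (hball (hmem x (mem_ball_self hρ) _ (hsphere θ))))
        (by fun_prop))
  have hint := intervalIntegral.hasFDerivAt_integral_of_dominated_of_fderiv_le
    (μ := MeasureTheory.volume) (a := 0) (b := 2 * Real.pi) (𝕜 := ℂ)
    (F := fun z θ => k θ • f (z + circleMap 0 r θ • e))
    (F' := fun z θ => k θ • fderiv ℂ f (z + circleMap 0 r θ • e))
    (bound := fun θ => ‖k θ‖ * C)
    (ball_mem_nhds x hρ)
    (eventually_of_mem (ball_mem_nhds x hρ) fun z hz => (hFc z hz).aestronglyMeasurable)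
    ((hFc x (mem_ball_self hρ)).intervalIntegrable _ _)
    hF'c.aestronglyMeasurable
    (Eventually.of_forall fun θ _ z hz => by
      rw [norm_smul]
      gcongr
      exact hbound _ (hmem z hz _ (hsphere θ)))
    ((hkc.norm.mul continuous_const).intervalIntegrable _ _)
    (Eventually.of_forall fun θ _ z hz =>
      ((hasFDerivAt_comp_add_right _).2 (hda _ (hmem z hz _ (hsphere θ))).hasFDerivAt).const_smul (k θ))
  have hd : DifferentiableAt ℂ
      (fun z => Complex.cderiv r (fun s : ℂ => f (z + s • e)) 0) x := by
    refine (hint.differentiableAt.const_smul (2 * Real.pi * Complex.I : ℂ)⁻¹).congr_of_eventuallyEq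
      (Eventually.of_forall fun z => ?_)
    simp only [Complex.cderiv, circleIntegral, smul_smul, hk, Pi.smul_apply]
  exact hd.congr_of_eventuallyEq
    (eventually_of_mem (ball_mem_nhds x hρ) fun z hz => (hcauchy z hz).symm)

/-- The derivative of a holomorphic map on a finite-dimensional space is holomorphic. -/
theorem DifferentiableOn.fderiv_of_finiteDimensional [FiniteDimensional ℂ E] [CompleteSpace F]
    {f : E → F} {U : Set E} (hf : DifferentiableOn ℂ f U) (hU : IsOpen U) :
    DifferentiableOn ℂ (fderiv ℂ f) U := by
  let b := Module.finBasis ℂ E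
  have : fderiv ℂ f = fun z => ∑ i, (ContinuousLinearMap.smulRightL ℂ E F
      (LinearMap.toContinuousLinearMap (b.coord i))) (fderiv ℂ f z (b i)) := by
    ext z v
    conv_lhs => rw [← b.sum_repr v, map_sum]
    simp
  rw [this]
  exact DifferentiableOn.fun_sum fun i _ =>
    (ContinuousLinearMap.differentiable _).comp_differentiableOn (hf.fderiv_apply hU (b i))

end Holomorphic

section NullFunctions

open Metric Set Filter Topology

/-- If an analytic function of one variable satisfies `h' = g h` and `h 0 = 0`, it vanishes near
`0`. -/
theorem AnalyticAt.eventually_eq_zero_of_deriv_eq_mul {h g : ℂ → ℂ} {z : ℂ}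
    (hh : AnalyticAt ℂ h z) (hg : AnalyticAt ℂ g z) (h0 : h z = 0)
    (hd : ∀ᶠ t in 𝓝 z, deriv h t = g t * h t) : ∀ᶠ t in 𝓝 z, h t = 0 := by
  rw [← analyticOrderAt_eq_top]
  have key : analyticOrderAt (deriv h) z + 1 = analyticOrderAt h z := by
    simpa [h0] using hh.analyticOrderAt_deriv_add_one
  rw [analyticOrderAt_congr hd,
    show (fun t => g t * h t) = g * h from rfl, analyticOrderAt_mul hg hh] at key
  by_contra hne
  obtain ⟨n, hn⟩ := ENat.ne_top_iff_exists.1 hne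
  rw [← hn] at key
  cases hg' : analyticOrderAt g z with
  | top => simp [hg'] at key
  | coe m =>
    rw [hg'] at key
    norm_cast at key
    omega

/-- A trace-free symmetric form on `ℂ³` with a nonzero isotropic vector `u` in its kernel vanishes
on `u^⊥`. -/
theorem form_apply_self_eq_zero_of_isotropic
    (B : (Fin 3 → ℂ) →L[ℂ] (Fin 3 → ℂ) →L[ℂ] ℂ) (L : (Fin 3 → ℂ) →L[ℂ] ℂ)
    (hB : ∀ a b, B a b = B b a)
    (htr : ∑ k, B (Pi.single k 1) (Pi.single k 1) = 0)
    (hker : ∀ a, ∑ k, L (Pi.single k 1) * B a (Pi.single k 1) = 0)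
    (hnull : ∑ k, L (Pi.single k 1) ^ 2 = 0) (hL : L ≠ 0)
    {w : Fin 3 → ℂ} (hw : L w = 0) : B w w = 0 := by
  have hsum : ∀ v : Fin 3 → ℂ, v = v 0 • Pi.single 0 1 + v 1 • Pi.single 1 1 +
      v 2 • Pi.single 2 1 := fun v => by
    ext i; fin_cases i <;> simp
  have hk : ∃ k, L (Pi.single k 1) ≠ 0 := by
    by_contra! hz
    refine hL (ContinuousLinearMap.ext fun v => ?_)
    rw [hsum v]
    simp [hz]
  have h0 := hker (Pi.single 0 1)
  have h1 := hker (Pi.single 1 1)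
  have h2 := hker (Pi.single 2 1)
  have e01 := hB (Pi.single 1 1) (Pi.single 0 1)
  have e02 := hB (Pi.single 2 1) (Pi.single 0 1)
  have e12 := hB (Pi.single 2 1) (Pi.single 1 1)
  rw [hsum w] at hw ⊢
  simp only [Fin.sum_univ_three, map_add, map_smul, add_apply,
    smul_apply, smul_eq_mul] at *
  rw [e01] at *
  rw [e02] at *
  rw [e12] at *
  generalize B (Pi.single 0 1) (Pi.single 0 1) = b00 at *
  generalize B (Pi.single 0 1) (Pi.single 1 1) = b01 at *
  generalize B (Pi.single 0 1) (Pi.single 2 1) = b02 at *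
  generalize B (Pi.single 1 1) (Pi.single 1 1) = b11 at *
  generalize B (Pi.single 1 1) (Pi.single 2 1) = b12 at *
  generalize B (Pi.single 2 1) (Pi.single 2 1) = b22 at *
  obtain ⟨k, hk⟩ := hk
  refine (mul_eq_zero_iff_left (pow_ne_zero 2 hk)).1 ?_
  fin_cases k <;> simp only [Fin.zero_eta, Fin.mk_one, Fin.reduceFinMk] <;>
  · generalize L (Pi.single 0 1) = l0 at *
    generalize L (Pi.single 1 1) = l1 at *
    generalize L (Pi.single 2 1) = l2 at *
    clear hk hB hker hL hsum e01 e02 e12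
    grind

/-- The level sets of a complex-harmonic function on `ℂ³` with isotropic gradient are, near a
regular point, flat. -/
theorem eventually_eq_of_isotropic_gradient {ζ : (Fin 3 → ℂ) → ℂ} {U : Set (Fin 3 → ℂ)}
    (hU : IsOpen U) (hζ : DifferentiableOn ℂ ζ U) (hlap : ∀ p ∈ U, lapC ζ p = 0)
    (hnull : ∀ p ∈ U, ∑ k, fderiv ℂ ζ p (Pi.single k 1) ^ 2 = 0)
    {x w : Fin 3 → ℂ} (hx : x ∈ U) (hreg : fderiv ℂ ζ x ≠ 0) (hw : fderiv ℂ ζ x w = 0) :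
    ∀ᶠ t : ℂ in 𝓝 0, ζ (x + t • w) = ζ x := by
  have hζ' := hζ.fderiv_of_finiteDimensional hU
  have hζ'' := hζ'.fderiv_of_finiteDimensional hU
  have hd : ∀ y ∈ U, HasFDerivAt ζ (fderiv ℂ ζ y) y := fun y hy =>
    (hζ.differentiableAt (hU.mem_nhds hy)).hasFDerivAt
  have hd' : ∀ y ∈ U, HasFDerivAt (fderiv ℂ ζ) (fderiv ℂ (fderiv ℂ ζ) y) y := fun y hy =>
    (hζ'.differentiableAt (hU.mem_nhds hy)).hasFDerivAt
  have hdir : ∀ y ∈ U, ∀ e, HasFDerivAt (fun z => fderiv ℂ ζ z e)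
      ((fderiv ℂ (fderiv ℂ ζ) y).flip e) y := fun y hy e => by
    simpa using (hd' y hy).clm_apply (hasFDerivAt_const e y)
  have hsymm : ∀ y ∈ U, ∀ a b, fderiv ℂ (fderiv ℂ ζ) y a b = fderiv ℂ (fderiv ℂ ζ) y b a :=
    fun y hy a b => second_derivative_symmetric_of_eventually
      (eventually_of_mem (hU.mem_nhds hy) hd) (hd' y hy) a b
  have htr : ∀ y ∈ U,
      ∑ k, fderiv ℂ (fderiv ℂ ζ) y (Pi.single k 1) (Pi.single k 1) = 0 := fun y hy => by
    rw [← hlap y hy]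
    exact Finset.sum_congr rfl fun k _ => by rw [(hdir y hy _).fderiv]; rfl
  have hker : ∀ y ∈ U, ∀ a, ∑ k, fderiv ℂ ζ y (Pi.single k 1) *
      fderiv ℂ (fderiv ℂ ζ) y a (Pi.single k 1) = 0 := fun y hy a => by
    have h1 : HasFDerivAt (fun z => ∑ k, fderiv ℂ ζ z (Pi.single k 1) ^ 2) _ y :=
      HasFDerivAt.fun_sum fun k _ => (hdir y hy (Pi.single k 1)).pow 2
    have h2 : HasFDerivAt (fun z => ∑ k, fderiv ℂ ζ z (Pi.single k 1) ^ 2) 0 y :=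
      (hasFDerivAt_const (𝕜 := ℂ) (0 : ℂ) y).congr_of_eventuallyEq
        (eventually_of_mem (hU.mem_nhds hy) hnull)
    have h3 := congrArg (fun T => T a) (h1.unique h2)
    simp only [sum_apply, smul_apply,
      ContinuousLinearMap.flip_apply, zero_apply] at h3
    simpa [mul_assoc, ← Finset.mul_sum] using h3
  obtain ⟨e, he⟩ : ∃ e, fderiv ℂ ζ x e ≠ 0 := by
    by_contra! hz
    exact hreg (ContinuousLinearMap.ext hz)
  set γ : ℂ → Fin 3 → ℂ := fun t => x + t • w with hγ
  have hγd : ∀ t, HasDerivAt γ w t := fun t => by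
    simpa [hγ] using ((hasDerivAt_id' t).smul_const w).const_add x
  have hγc : Continuous γ := by fun_prop
  have hγ0 : γ 0 = x := by simp [hγ]
  have hUγ : ∀ᶠ t in 𝓝 (0 : ℂ), γ t ∈ U ∧ fderiv ℂ ζ (γ t) e ≠ 0 := by
    have h1 : ∀ᶠ y in 𝓝 x, y ∈ U ∧ fderiv ℂ ζ y e ≠ 0 :=
      Eventually.and (hU.mem_nhds hx) ((hdir x hx e).continuousAt.eventually_ne he)
    exact hγc.continuousAt.eventually (by rwa [hγ0])
  set D := fderiv ℂ (fderiv ℂ ζ)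
  set h : ℂ → ℂ := fun t => fderiv ℂ ζ (γ t) w with hh
  set g : ℂ → ℂ := fun t => (2 * D (γ t) w e - h t / fderiv ℂ ζ (γ t) e * D (γ t) e e) /
    fderiv ℂ ζ (γ t) e with hg
  have hDdiff : ∀ t, γ t ∈ U → DifferentiableAt ℂ (fun t => D (γ t)) t := fun t ht =>
    (hζ''.differentiableAt (hU.mem_nhds ht)).comp t (hγd t).differentiableAt
  have hdiff : ∀ t, γ t ∈ U → DifferentiableAt ℂ (fun t => fderiv ℂ ζ (γ t)) t := fun t ht =>
    (hd' _ ht).differentiableAt.comp t (hγd t).differentiableAt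
  have hhd : ∀ t, γ t ∈ U → HasDerivAt h (D (γ t) w w) t := fun t ht =>
    (hdir _ ht w).comp_hasDerivAt t (hγd t)
  have hha : AnalyticAt ℂ h 0 := Complex.analyticAt_iff_eventually_differentiableAt.2
    (hUγ.mono fun t ht => (hhd t ht.1).differentiableAt)
  have hga : AnalyticAt ℂ g 0 := Complex.analyticAt_iff_eventually_differentiableAt.2
    (hUγ.mono fun t ht => by
      have h1 : ∀ a, DifferentiableAt ℂ (fun t => D (γ t) a e) t := fun a =>
        ((hDdiff t ht.1).clm_apply (differentiableAt_const a)).clm_apply (differentiableAt_const e)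
      have h2 := (hdiff t ht.1).clm_apply (differentiableAt_const e)
      have h3 := (hhd t ht.1).differentiableAt
      have h4 := ht.2
      exact (((h1 w).const_mul 2).sub ((h3.div h2 h4).mul (h1 e))).div h2 h4)
  have hode : ∀ᶠ t in 𝓝 (0 : ℂ), deriv h t = g t * h t := hUγ.mono fun t ht => by
    have hz := form_apply_self_eq_zero_of_isotropic (D (γ t)) (fderiv ℂ ζ (γ t))
      (hsymm _ ht.1) (htr _ ht.1) (hker _ ht.1) (hnull _ ht.1)
      (fun h0 => ht.2 (by simp [h0])) (w := w - (h t / fderiv ℂ ζ (γ t) e) • e)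
      (by simp [hh, ht.2])
    rw [(hhd t ht.1).deriv, hg]
    simp only [map_sub, map_smul, sub_apply, smul_apply,
      smul_eq_mul, hsymm _ ht.1 e w] at hz
    have h4 := ht.2
    linear_combination hz
  have hzero := hha.eventually_eq_zero_of_deriv_eq_mul hga (by simpa [hh, hγ0] using hw) hode
  obtain ⟨r, hr, hball⟩ := Metric.eventually_nhds_iff_ball.1 (hzero.and hUγ)
  filter_upwards [ball_mem_nhds (0 : ℂ) hr] with t ht
  have hcd : ∀ s ∈ ball (0 : ℂ) r, HasDerivAt (fun s => ζ (γ s)) 0 s := fun s hs => by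
    have := (hd _ (hball s hs).2.1).comp_hasDerivAt s (hγd s)
    rwa [show fderiv ℂ ζ (γ s) w = 0 from (hball s hs).1] at this
  have := isOpen_ball.is_const_of_deriv_eq_zero (convex_ball (0 : ℂ) r).isPreconnected
    (fun s hs => (hcd s hs).differentiableAt.differentiableWithinAt)
    (fun s hs => (hcd s hs).deriv) ht (mem_ball_self hr)
  simpa [hγ] using this

end NullFunctions

section Morphisms

open Metric Set Filter Topology

/-- Near a point where its derivative is surjective, the fibre of a strictly differentiable map
through that point projects injectively to the kernel of the derivative; in particular it lies in
the affine kernel once the affine kernel lies in the fibre. -/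
theorem HasStrictFDerivAt.eventually_sub_mem_ker {E F : Type*} [NormedAddCommGroup E]
    [NormedSpace ℂ E] [CompleteSpace E] [NormedAddCommGroup F] [NormedSpace ℂ F]
    [FiniteDimensional ℂ F] {f : E → F} {f' : E →L[ℂ] F} {x : E}
    (hf : HasStrictFDerivAt f f' x) (hsurj : Function.Surjective f')
    (hflat : ∀ᶠ y in 𝓝 x, y - x ∈ f'.ker → f y = f x) :
    ∀ᶠ y in 𝓝 x, f y = f x → y - x ∈ f'.ker := by
  have hr : f'.range = ⊤ := LinearMap.range_eq_top.2 hsurj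
  set Ψ := hf.implicitToOpenPartialHomeomorph f f' hr with hΨ
  have hxs : x ∈ Ψ.source := hf.mem_implicitToOpenPartialHomeomorph_source hr
  have hsrc : ∀ᶠ y in 𝓝 x, y ∈ Ψ.source := Ψ.open_source.mem_nhds hxs
  have hproj : Tendsto (fun y => ((Ψ y).2 : E) + x) (𝓝 x) (𝓝 x) := by
    have h1 : ContinuousAt (fun y => ((Ψ y).2 : E) + x) x :=
      (continuous_subtype_val.continuousAt.comp (Ψ.continuousAt hxs).snd).add continuousAt_const
    have h2 : ((Ψ x).2 : E) + x = x := by simp [hΨ]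
    simpa [ContinuousAt, h2] using h1
  filter_upwards [hsrc, hproj.eventually hsrc, hproj.eventually hflat] with y hy hy' hflat' hfy
  have h1 : Ψ (((Ψ y).2 : E) + x) = (f (((Ψ y).2 : E) + x), (Ψ y).2) :=
    hf.implicitToOpenPartialHomeomorph_apply_ker hr _
  have h2 : Ψ y = Ψ (((Ψ y).2 : E) + x) := by
    rw [h1, hflat' (by rw [add_sub_cancel_right]; exact (Ψ y).2.2), ← hfy]
    rfl
  rw [Ψ.injOn hy hy' h2, add_sub_cancel_right]
  exact (Ψ y).2.2

theorem complexHarmonicOnB_linear (ε : ℂ) :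
    ComplexHarmonicOnB (fun q => q.1 + ε * q.2) univ := by
  have hd : ∀ w : ℂ × ℂ, HasFDerivAt (fun q : ℂ × ℂ => q.1 + ε * q.2)
      (ContinuousLinearMap.fst ℂ ℂ ℂ + ε • ContinuousLinearMap.snd ℂ ℂ ℂ) w := fun w =>
    hasFDerivAt_fst.add (hasFDerivAt_snd.const_mul ε)
  refine ⟨fun w _ => (hd w).differentiableAt.differentiableWithinAt, fun p _ => ?_⟩
  simp [lapB, (hd _).fderiv]

theorem complexHarmonicOnB_linear_sq {ε : ℂ} (hε : ε ^ 2 = -1) :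
    ComplexHarmonicOnB (fun q => (q.1 + ε * q.2) ^ 2) univ := by
  have hd : ∀ w : ℂ × ℂ, HasFDerivAt (fun q : ℂ × ℂ => q.1 + ε * q.2)
      (ContinuousLinearMap.fst ℂ ℂ ℂ + ε • ContinuousLinearMap.snd ℂ ℂ ℂ) w := fun w =>
    hasFDerivAt_fst.add (hasFDerivAt_snd.const_mul ε)
  have hd2 : ∀ w e : ℂ × ℂ, fderiv ℂ (fun q : ℂ × ℂ => (q.1 + ε * q.2) ^ 2) w e =
      2 * (e.1 + ε * e.2) * (w.1 + ε * w.2) := fun w e => by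
    rw [((hd w).pow 2).fderiv]
    simp
    ring
  refine ⟨fun w _ => ((hd w).pow 2).differentiableAt.differentiableWithinAt, fun p _ => ?_⟩
  simp only [lapB, hd2]
  rw [((hd p).const_mul _).fderiv, ((hd p).const_mul _).fderiv]
  simp
  linear_combination 2 * hε

theorem lapC_sq {m : ℕ} {ζ : (Fin m → ℂ) → ℂ} {U : Set (Fin m → ℂ)} (hU : IsOpen U)
    (hζ : DifferentiableOn ℂ ζ U) {p : Fin m → ℂ} (hp : p ∈ U) :
    lapC (fun z => ζ z ^ 2) p =
      2 * ∑ k, fderiv ℂ ζ p (Pi.single k 1) ^ 2 + 2 * ζ p * lapC ζ p := by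
  have hd : ∀ y ∈ U, HasFDerivAt ζ (fderiv ℂ ζ y) y := fun y hy =>
    (hζ.differentiableAt (hU.mem_nhds hy)).hasFDerivAt
  simp only [lapC, Finset.mul_sum, ← Finset.sum_add_distrib]
  refine Finset.sum_congr rfl fun k _ => ?_
  have h1 : (fun z => fderiv ℂ (fun z => ζ z ^ 2) z (Pi.single k 1)) =ᶠ[𝓝 p]
      fun z => 2 * (ζ z * fderiv ℂ ζ z (Pi.single k 1)) :=
    eventually_of_mem (hU.mem_nhds hp) fun z hz => by
      simp only [((hd z hz).pow 2).fderiv]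
      simp
      ring
  have h2 := ((hζ.fderiv_apply hU (Pi.single k 1)).differentiableAt (hU.mem_nhds hp)).hasFDerivAt
  rw [h1.fderiv_eq, (((hd p hp).fun_mul h2).const_mul 2).fderiv]
  simp
  ring

theorem IsCHMB.isotropic {m : ℕ} {Φ : (Fin m → ℂ) → ℂ × ℂ} {U : Set (Fin m → ℂ)}
    (hCHM : IsCHMB Φ U) (hU : IsOpen U) {ε : ℂ} (hε : ε ^ 2 = -1) {p : Fin m → ℂ} (hp : p ∈ U) :
    lapC (fun z => (Φ z).1 + ε * (Φ z).2) p = 0 ∧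
      ∑ k, fderiv ℂ (fun z => (Φ z).1 + ε * (Φ z).2) p (Pi.single k 1) ^ 2 = 0 := by
  have hne : (U ∩ Φ ⁻¹' univ).Nonempty := ⟨p, hp, mem_univ _⟩
  have h1 := hCHM univ isOpen_univ _ (complexHarmonicOnB_linear ε) hne
  have h2 := hCHM univ isOpen_univ _ (complexHarmonicOnB_linear_sq hε) hne
  rw [preimage_univ, inter_univ] at h1 h2
  have h3 : lapC (fun z => (Φ z).1 + ε * (Φ z).2) p = 0 := h1.2 p hp
  have h4 : lapC (fun z => ((Φ z).1 + ε * (Φ z).2) ^ 2) p = 0 := h2.2 p hp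
  rw [lapC_sq (ζ := fun z => (Φ z).1 + ε * (Φ z).2) hU h1.1 hp] at h4
  refine ⟨h3, ?_⟩
  simpa [h3] using h4

/-- A submersive complex-harmonic morphism is constant along short segments tangent to its
fibre. -/
theorem IsCHMB.eventually_eq_of_mem_ker {Φ : (Fin 3 → ℂ) → ℂ × ℂ} {U : Set (Fin 3 → ℂ)}
    (hCHM : IsCHMB Φ U) (hU : IsOpen U) (hΦ : DifferentiableOn ℂ Φ U) {x w : Fin 3 → ℂ}
    (hx : x ∈ U) (hsub : Function.Surjective (fderiv ℂ Φ x)) (hw : fderiv ℂ Φ x w = 0) :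
    ∀ᶠ t : ℂ in 𝓝 0, Φ (x + t • w) = Φ x := by
  have key : ∀ ε : ℂ, ε ^ 2 = -1 → ∀ᶠ t : ℂ in 𝓝 0,
      (Φ (x + t • w)).1 + ε * (Φ (x + t • w)).2 = (Φ x).1 + ε * (Φ x).2 := by
    intro ε hε
    have hd : HasFDerivAt (fun z => (Φ z).1 + ε * (Φ z).2)
        ((ContinuousLinearMap.fst ℂ ℂ ℂ + ε • ContinuousLinearMap.snd ℂ ℂ ℂ).comp
          (fderiv ℂ Φ x)) x := by
      have h := (hΦ.differentiableAt (hU.mem_nhds hx)).hasFDerivAt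
      exact h.fst.add (h.snd.const_mul ε)
    refine eventually_eq_of_isotropic_gradient hU (hΦ.fst.fun_add (hΦ.snd.const_mul ε))
      (fun p hp => (hCHM.isotropic hU hε hp).1) (fun p hp => (hCHM.isotropic hU hε hp).2)
      hx ?_ ?_
    · obtain ⟨v, hv⟩ := hsub (1, 0)
      intro h0
      have := congrArg (fun T => T v) h0
      simp [hd.fderiv, hv] at this
    · simp [hd.fderiv, hw]
  filter_upwards [key Complex.I (by simp), key (-Complex.I) (by simp)] with t h1 h2
  have h3 : (Φ (x + t • w)).1 = (Φ x).1 := by linear_combination (h1 + h2) / 2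
  refine Prod.ext h3 (mul_left_cancel₀ Complex.I_ne_zero ?_)
  linear_combination (h1 - h2) / 2

theorem exists_ker_eq_span_singleton {f : (Fin 3 → ℂ) →L[ℂ] ℂ × ℂ}
    (hf : Function.Surjective f) :
    ∃ w : Fin 3 → ℂ, w ≠ 0 ∧ f.ker = ℂ ∙ w := by
  have h1 := f.toLinearMap.finrank_range_add_finrank_ker
  rw [LinearMap.range_eq_top.2 hf] at h1
  simp only [finrank_top, Module.finrank_prod, Module.finrank_self, Module.finrank_fin_fun] at h1
  have h2 : Module.finrank ℂ f.ker = 1 := by omega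
  obtain ⟨⟨w, hwk⟩, hw0, hw⟩ := finrank_eq_one_iff'.1 h2
  refine ⟨w, fun h => hw0 (Subtype.ext h), le_antisymm (fun v hv => ?_) ?_⟩
  · obtain ⟨c, hc⟩ := hw ⟨v, hv⟩
    exact Submodule.mem_span_singleton.2 ⟨c, congrArg Subtype.val hc⟩
  · rwa [Submodule.span_singleton_le_iff_mem]

/-- Near each point, the fibre of a submersive complex-harmonic morphism is the affine kernel of
its derivative. -/
theorem IsCHMB.eventually_eq_iff {Φ : (Fin 3 → ℂ) → ℂ × ℂ} {U : Set (Fin 3 → ℂ)}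
    (hCHM : IsCHMB Φ U) (hU : IsOpen U) (hΦ : DifferentiableOn ℂ Φ U) {x : Fin 3 → ℂ}
    (hx : x ∈ U) (hsub : Function.Surjective (fderiv ℂ Φ x)) :
    ∀ᶠ y in 𝓝 x, (Φ y = Φ x ↔ y - x ∈ (fderiv ℂ Φ x).ker) := by
  obtain ⟨w, hw0, hw⟩ := exists_ker_eq_span_singleton hsub
  have hwk : fderiv ℂ Φ x w = 0 := by
    have : w ∈ (fderiv ℂ Φ x).ker := hw ▸ Submodule.mem_span_singleton_self w
    exact this
  have hflat : ∀ᶠ y in 𝓝 x, y - x ∈ (fderiv ℂ Φ x).ker → Φ y = Φ x := by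
    obtain ⟨r, hr, hball⟩ := Metric.eventually_nhds_iff_ball.1
      (hCHM.eventually_eq_of_mem_ker hU hΦ hx hsub hwk)
    have hw0' : 0 < ‖w‖ := norm_pos_iff.2 hw0
    filter_upwards [ball_mem_nhds x (mul_pos hr hw0')] with y hy hyk
    rw [hw, Submodule.mem_span_singleton] at hyk
    obtain ⟨t, ht⟩ := hyk
    rw [mem_ball, dist_eq_norm, ← ht, norm_smul] at hy
    have := hball t (mem_ball_zero_iff.2 (lt_of_mul_lt_mul_right hy hw0'.le))
    rwa [ht, add_sub_cancel] at this
  filter_upwards [hflat, (hΦ.hasStrictFDerivAt hU hx).eventually_sub_mem_ker hsub hflat]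
    with y h1 h2
  exact ⟨h2, h1⟩

theorem IsCHMB.eventually_ker_eq {Φ : (Fin 3 → ℂ) → ℂ × ℂ} {U : Set (Fin 3 → ℂ)}
    (hCHM : IsCHMB Φ U) (hU : IsOpen U) (hΦ : DifferentiableOn ℂ Φ U)
    (hsub : ∀ p ∈ U, Function.Surjective (fderiv ℂ Φ p)) {x : Fin 3 → ℂ} (hx : x ∈ U) :
    ∀ᶠ y in 𝓝 x, Φ y = Φ x → (fderiv ℂ Φ y).ker = (fderiv ℂ Φ x).ker := by
  filter_upwards [(hCHM.eventually_eq_iff hU hΦ hx (hsub x hx)).eventually_nhds,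
    hU.mem_nhds hx] with y hy hyU hΦy
  obtain ⟨w, hw0, hw⟩ := exists_ker_eq_span_singleton (hsub x hx)
  obtain ⟨v, hv0, hv⟩ := exists_ker_eq_span_singleton (hsub y hyU)
  have hwk : w ∈ (fderiv ℂ Φ x).ker := hw ▸ Submodule.mem_span_singleton_self w
  have hyk : y - x ∈ (fderiv ℂ Φ x).ker := hy.self_of_nhds.1 hΦy
  have hγ : HasDerivAt (fun t : ℂ => y + t • w) w 0 := by
    simpa using ((hasDerivAt_id' (0 : ℂ)).smul_const w).const_add y
  have hγ0 : y + (0 : ℂ) • w = y := by simp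
  have hconst : ∀ᶠ t : ℂ in 𝓝 0, Φ (y + t • w) = Φ x := by
    have h := hγ.continuousAt.tendsto
    rw [hγ0] at h
    filter_upwards [h.eventually hy] with t ht
    refine ht.2 ?_
    rw [add_sub_right_comm]
    exact add_mem hyk (Submodule.smul_mem _ t hwk)
  have hder : HasDerivAt (fun t : ℂ => Φ (y + t • w)) (fderiv ℂ Φ y w) 0 := by
    have h := (hΦ.differentiableAt (hU.mem_nhds hyU)).hasFDerivAt
    rw [← hγ0] at h
    simpa [Function.comp_def] using h.comp_hasDerivAt (0 : ℂ) hγ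
  have hwy : w ∈ (fderiv ℂ Φ y).ker :=
    hder.unique ((hasDerivAt_const (0 : ℂ) (Φ x)).congr_of_eventuallyEq hconst)
  rw [hv, hw]
  rw [hv, Submodule.mem_span_singleton] at hwy
  obtain ⟨c, rfl⟩ := hwy
  have hc : c ≠ 0 := by
    rintro rfl
    simp at hw0
  exact (Submodule.span_singleton_smul_eq hc.isUnit v).symm

end Morphisms

/-- the connected components of the fibres of a submersive
complex-harmonic morphism `Φ : U → ℂ²` (`U ⊆ ℂ³` open) are open subsets of affine
complex lines in `ℂ³`. -/
theorem fibres_are_lines (U : Set (Fin 3 → ℂ)) (hU : IsOpen U)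
    (Φ : (Fin 3 → ℂ) → ℂ × ℂ) (hΦ : DifferentiableOn ℂ Φ U)
    (hCHM : IsCHMB Φ U)
    (hsub : ∀ p ∈ U, Function.Surjective (fderiv ℂ Φ p))
    (q : ℂ × ℂ) (p : Fin 3 → ℂ) (hp : p ∈ U) (hpq : Φ p = q) :
    ∃ w : Fin 3 → ℂ, w ≠ 0 ∧ ∃ V : Set (Fin 3 → ℂ), IsOpen V ∧
      connectedComponentIn (U ∩ Φ ⁻¹' {q}) p =
        V ∩ {x : Fin 3 → ℂ | ∃ t : ℂ, x = p + t • w} := by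
  subst hpq
  obtain ⟨w, hw0, hw⟩ := exists_ker_eq_span_singleton (hsub p hp)
  set S := U ∩ Φ ⁻¹' {Φ p} with hS
  have hpS : p ∈ S := ⟨hp, rfl⟩
  set C := connectedComponentIn S p with hC
  have hpC : p ∈ C := mem_connectedComponentIn hpS
  have hCS : C ⊆ S := connectedComponentIn_subset S p
  have hloc := fun x (hx : x ∈ S) => hCHM.eventually_eq_iff hU hΦ hx.1 (hsub x hx.1)
  have hker : ∀ x ∈ C, (fderiv ℂ Φ x).ker = (fderiv ℂ Φ p).ker ∧ x - p ∈ (fderiv ℂ Φ p).ker := by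
    intro x hx
    refine isPreconnected_connectedComponentIn.induction₂'
      (fun a b => (fderiv ℂ Φ b).ker = (fderiv ℂ Φ a).ker ∧ b - a ∈ (fderiv ℂ Φ a).ker)
      (fun a ha => ?_) (fun a b c _ _ _ hab hbc => ?_) hpC hx
    · filter_upwards [nhdsWithin_le_nhds (hloc a (hCS ha)),
        nhdsWithin_le_nhds (hCHM.eventually_ker_eq hU hΦ hsub (hCS ha).1),
        self_mem_nhdsWithin] with b h1 h2 hb
      have hab : Φ b = Φ a := (hCS hb).2.trans (hCS ha).2.symm
      refine ⟨⟨h2 hab, h1.1 hab⟩, (h2 hab).symm, ?_⟩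
      rw [h2 hab, ← neg_sub]
      exact neg_mem (h1.1 hab)
    · refine ⟨hbc.1.trans hab.1, ?_⟩
      rw [← sub_add_sub_cancel]
      exact add_mem (hab.1 ▸ hbc.2) hab.2
  have hline : ∀ x : Fin 3 → ℂ, (∃ t : ℂ, x = p + t • w) ↔ x - p ∈ (fderiv ℂ Φ p).ker := by
    intro x
    rw [hw, Submodule.mem_span_singleton]
    exact exists_congr fun t => by rw [eq_sub_iff_add_eq', eq_comm]
  refine ⟨w, hw0, interior {x | x - p ∈ (fderiv ℂ Φ p).ker → x ∈ C}, isOpen_interior,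
    Set.Subset.antisymm (fun x hx => ⟨?_, (hline x).2 (hker x hx).2⟩)
      fun x hx => interior_subset hx.1 ((hline x).1 hx.2)⟩
  obtain ⟨hkx, hxp⟩ := hker x hx
  have hxS := hCS hx
  obtain ⟨r, hr, hball⟩ := Metric.eventually_nhds_iff_ball.1
    ((hloc x hxS).and (hU.mem_nhds hxS.1))
  refine mem_interior.2 ⟨Metric.ball x r, fun y hy hyp => ?_, Metric.isOpen_ball,
    Metric.mem_ball_self hr⟩
  have hconv : Convex ℝ (Metric.ball x r ∩ {y | y - x ∈ (fderiv ℂ Φ x).ker}) := by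
    refine (convex_ball x r).inter fun a ha b hb s t _ _ hst => ?_
    have : s • a + t • b - x = (s : ℂ) • (a - x) + (t : ℂ) • (b - x) := by
      ext i
      have hst' : (s : ℂ) + t = 1 := by exact_mod_cast hst
      simp
      linear_combination x i * hst'
    rw [Set.mem_ofPred_eq, this]
    exact add_mem (Submodule.smul_mem _ _ ha) (Submodule.smul_mem _ _ hb)
  rw [hC, connectedComponentIn_eq hx]
  refine hconv.isPreconnected.subset_connectedComponentIn
    ⟨Metric.mem_ball_self hr, by simp⟩ (fun z hz => ?_) ⟨hy, ?_⟩
  · exact ⟨(hball z hz.1).2, ((hball z hz.1).1.2 hz.2).trans hxS.2⟩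
  · rw [Set.mem_ofPred_eq, hkx, ← sub_sub_sub_cancel_right y x p]
    exact sub_mem hyp hxp
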